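/- Let l ≥ 1 and let m : Fin l → ℕ satisfy 1 < m i for all i and 2 < m i for at least one i. In the abelian group G = ∀ i, (ZMod (m i))ˣ, let z : G be the element whose every coordinate is -1 (so z has order 2). Then the cyclic subgroup Subgroup.zpowers z admits a complement in G (i.e., there is a subgroup H with Subgroup.IsComplement' (Subgroup.zpowers z) H; equivalently the short exact sequence 1 → ℤ/2 → G → G/⟨z⟩ → 1 splits) if and only if there exists an index i such that either 4 divides m i or there exists a prime p with p ≡ 3 (mod 4) dividing m i. -/

import Mathlib

theorem aux_prime_pow (p k : ℕ) (hp : p.Prime) (h : p % 4 = 1) :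
    IsSquare (-1 : ZMod (p ^ (k + 1))) := by
  haveI := Fact.mk hp
  have h1 : IsSquare (-1 : ZMod p) := ZMod.exists_sq_eq_neg_one_iff.mpr (by omega)
  obtain ⟨a, ha⟩ := h1
  obtain ⟨b, rfl⟩ := ZMod.intCast_surjective a
  have h2 : (p : ℤ) ∣ b * b - (-1) := by
    rw [← ZMod.intCast_zmod_eq_zero_iff_dvd] <;> try infer_instance
    push_cast
    rw [← ha]; ring
  have h3 := dvd_sub_pow_of_dvd_sub h2 k
  have hodd : Odd (p ^ k) := Odd.pow (Nat.odd_iff.mpr (by omega))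
  rw [hodd.neg_one_pow] at h3
  refine ⟨(b : ZMod (p ^ (k + 1))) ^ p ^ k, ?_⟩
  have h4 : (((b * b) ^ p ^ k - (-1) : ℤ) : ZMod (p ^ (k + 1))) = 0 := by
    rw [ZMod.intCast_zmod_eq_zero_iff_dvd]
    exact_mod_cast h3
  push_cast at h4
  rw [← mul_pow]
  linear_combination -h4

theorem aux_square (n : ℕ) (h4 : ¬ 4 ∣ n) (h3 : ∀ p : ℕ, p.Prime → p % 4 = 3 → ¬ p ∣ n) :
    IsSquare (-1 : ZMod n) := by
  induction n using Nat.recOnPosPrimePosCoprime with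
  | zero => simp at h4
  | one => exact ⟨0, Subsingleton.elim _ _⟩
  | prime_pow p k hp hk =>
    obtain ⟨k, rfl⟩ : ∃ j, k = j + 1 := ⟨k - 1, by omega⟩
    rcases hp.eq_two_or_odd with rfl | ho
    · rcases k with _ | k
      · exact ⟨1, by decide⟩
      · exact absurd ⟨2 ^ k, by ring⟩ h4
    · have : ¬ p % 4 = 3 := fun h => h3 p hp h (dvd_pow_self p (by omega))
      exact aux_prime_pow p k hp (by omega)
  | coprime a b ha hb hab iha ihb =>
    refine ZMod.isSquare_neg_one_mul hab (iha ?_ ?_) (ihb ?_ ?_)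
    · exact fun h => h4 (h.mul_right b)
    · exact fun p hp h h' => h3 p hp h (h'.mul_right b)
    · exact fun h => h4 (h.mul_left a)
    · exact fun p hp h h' => h3 p hp h (h'.mul_left a)

theorem aux_complement {G : Type*} [CommGroup G] (z : G) (hz : z ^ 2 = 1) (f : G →* ℤˣ)
    (hf : f z = -1) : (Subgroup.zpowers z).IsComplement' f.ker := by
  apply Subgroup.isComplement'_of_disjoint_and_mul_eq_univ
  · rw [Subgroup.disjoint_def]
    rintro x ⟨k, rfl⟩ hx
    have hx : f (z ^ k) = 1 := hx
    rw [map_zpow, hf] at hx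
    rcases Int.even_or_odd' k with ⟨j, rfl | rfl⟩
    · change z ^ (2 * j) = 1
      rw [zpow_mul]
      simp [hz]
    · rw [zpow_add, zpow_mul] at hx
      simp at hx
  · rw [Set.eq_univ_iff_forall]
    intro x
    rcases Int.units_eq_one_or (f x) with h | h
    · exact ⟨1, Subgroup.one_mem _, x, h, one_mul x⟩
    · refine ⟨z, Subgroup.mem_zpowers z, z⁻¹ * x, ?_, by simp⟩
      change f (z⁻¹ * x) = 1
      rw [map_mul, map_inv, hf, h]; simp

theorem aux_hom (n N : ℕ) (h : n ∣ N) (χ : MulChar (ZMod n) ℤ) (hχ : χ (-1) = -1) :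
    ∃ f : (ZMod N)ˣ →* ℤˣ, f (-1) = -1 := by
  refine ⟨χ.toUnitHom.comp (ZMod.unitsMap h), ?_⟩
  have : ZMod.unitsMap h (-1) = -1 := by
    ext; simp [ZMod.unitsMap]
  rw [MonoidHom.comp_apply, this]
  ext
  rw [MulChar.coe_toUnitHom]
  simpa using hχ

/-- Splitting criterion for the elementwise-`-1` involution in a finite product of unit
groups `(ZMod (m i))ˣ`: the cyclic subgroup it generates admits a complement iff some `m i`
is divisible by `4` or by a prime `p ≡ 3 (mod 4)`. -/
theorem statement17 (l : ℕ) (hl : 1 ≤ l) (m : Fin l → ℕ)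
    (hm : ∀ i, 1 < m i) (hm2 : ∃ i, 2 < m i) :
    (∃ H : Subgroup (∀ i, (ZMod (m i))ˣ),
        (Subgroup.zpowers (fun i => (-1 : (ZMod (m i))ˣ))).IsComplement' H) ↔
      ∃ i, 4 ∣ m i ∨ ∃ p : ℕ, p.Prime ∧ p % 4 = 3 ∧ p ∣ m i := by
  have hz2 : (fun i => (-1 : (ZMod (m i))ˣ)) ^ 2 = 1 := by
    funext i; simp
  constructor
  · rintro ⟨H, hH⟩
    by_contra hcon
    push Not at hcon
    have hsq : ∀ i, ∃ u : (ZMod (m i))ˣ, u * u = -1 := by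
      intro i
      obtain ⟨a, ha⟩ := aux_square (m i) (hcon i).1 (hcon i).2
      refine ⟨⟨a, -a, by linear_combination ha, by linear_combination ha⟩, ?_⟩
      ext
      simp [ha]
    choose w hw using hsq
    obtain ⟨⟨⟨a, k, hk⟩, ⟨h, hh⟩⟩, hab⟩ := hH.2 w
    simp only at hab hk
    have hzH : (fun i => (-1 : (ZMod (m i))ˣ)) ∈ H := by
      have h1 : (fun i => (-1 : (ZMod (m i))ˣ)) = w ^ 2 := by
        funext i; simp [pow_two, hw]
      have h2 : a ^ 2 = 1 := by
        rw [← hk, ← zpow_natCast, ← zpow_mul, mul_comm, zpow_mul, zpow_natCast, hz2, one_zpow]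
      rw [h1, ← hab, mul_pow, h2, one_mul]
      exact H.pow_mem hh 2
    have h1 := (Subgroup.disjoint_def.mp hH.disjoint) (Subgroup.mem_zpowers _) hzH
    obtain ⟨i, hi⟩ := hm2
    haveI : Fact (2 < m i) := ⟨hi⟩
    have h5 := congrArg Units.val (congrFun h1 i)
    exact ZMod.neg_one_ne_one (by simpa using h5)
  · rintro ⟨i, hi⟩
    obtain ⟨f, hf⟩ : ∃ f : (ZMod (m i))ˣ →* ℤˣ, f (-1) = -1 := by
      rcases hi with h | ⟨p, hp, hp3, h⟩
      · exact aux_hom 4 _ h ZMod.χ₄ (by decide)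
      · haveI := Fact.mk hp
        refine aux_hom p _ h (quadraticChar (ZMod p)) ?_
        rw [quadraticChar_neg_one_iff_not_isSquare, ZMod.exists_sq_eq_neg_one_iff]
        simpa using hp3
    exact ⟨_, aux_complement _ hz2 (f.comp (Pi.evalMonoidHom _ i)) hf⟩
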